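/- The map ε from the set of idempotent proper filters of S to the set of E-filters given by ε(F) := F ∩ E is a well-defined bijection, whose inverse sends an E-filter ξ to ↑ξ = {b ∈ S : e ≤ b for some e ∈ ξ}. -/

import Mathlib

/-- An inverse semigroup with zero: every element `a` has a unique `a⁻¹` with
`a * a⁻¹ * a = a` and `a⁻¹ * a * a⁻¹ = a⁻¹`, and `0` is absorbing. -/
class InvSemigroupWithZero (S : Type*) extends Semigroup S, Zero S, Inv S where
  mul_inv_mul : ∀ a : S, a * a⁻¹ * a = a
  inv_mul_inv : ∀ a : S, a⁻¹ * a * a⁻¹ = a⁻¹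
  inv_unique : ∀ a b : S, a * b * a = a → b * a * b = b → b = a⁻¹
  zero_mul : ∀ a : S, 0 * a = 0
  mul_zero : ∀ a : S, a * 0 = 0

namespace InvSemigroupWithZero

variable {S : Type*} [InvSemigroupWithZero S]

/-- The natural partial order on `S`: `a ≤ b` iff `a = a * a⁻¹ * b`. -/
def sle (a b : S) : Prop := a = a * a⁻¹ * b

/-- `↓s`, the down-set of `s` w.r.t. the natural partial order. -/
def dwn (s : S) : Set S := {t : S | sle t s}

/-- `↑A`, the up-set generated by `A` w.r.t. the natural partial order. -/
def up (A : Set S) : Set S := {b : S | ∃ a ∈ A, sle a b}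

/-- A filter in `S`: a nonempty down-directed up-set. -/
def IsFilt (F : Set S) : Prop :=
  F.Nonempty ∧ up F = F ∧ ∀ a ∈ F, ∀ b ∈ F, ∃ c ∈ F, sle c a ∧ sle c b

/-- A proper filter: a filter not containing `0`. -/
def IsPFilt (F : Set S) : Prop := IsFilt F ∧ (0 : S) ∉ F

/-- An ultrafilter: a proper filter maximal among proper filters. -/
def IsUltra (U : Set S) : Prop :=
  IsPFilt U ∧ ∀ G : Set S, IsPFilt G → U ⊆ G → U = G

/-- The set `E` of idempotents of `S`. -/
def E (S : Type*) [InvSemigroupWithZero S] : Set S := {e : S | e * e = e}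

/-- `F⁻¹ = {a⁻¹ : a ∈ F}`. -/
def finv (F : Set S) : Set S := (fun a : S => a⁻¹) '' F

/-- `F · G = ↑{fg : f ∈ F, g ∈ G}`. -/
def fmul (F G : Set S) : Set S := up (Set.image2 (· * ·) F G)

/-- The source `d(F) := F⁻¹ · F`. -/
def src (F : Set S) : Set S := fmul (finv F) F

/-- The range `r(F) := F · F⁻¹`. -/
def rng (F : Set S) : Set S := fmul F (finv F)

/-- The natural partial order on the idempotents: `e ≤ f` iff `e = e * f`. -/
def ele (e f : S) : Prop := e = e * f

/-- The down-set of an idempotent `e` inside `E`. -/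
def edwn (e : S) : Set S := {f : S | f ∈ E S ∧ ele f e}

/-- The up-set generated by `A` inside `E`. -/
def eup (A : Set S) : Set S := {f : S | f ∈ E S ∧ ∃ a ∈ A, ele a f}

/-- An `E`-filter: a proper filter of the inverse semigroup `E` of idempotents. -/
def IsEFilt (ξ : Set S) : Prop :=
  ξ ⊆ E S ∧ ξ.Nonempty ∧ eup ξ = ξ ∧
    (∀ a ∈ ξ, ∀ b ∈ ξ, ∃ c ∈ ξ, ele c a ∧ ele c b) ∧ (0 : S) ∉ ξ

/-- An `E`-ultrafilter: an `E`-filter maximal among `E`-filters. -/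
def IsEUltra (ξ : Set S) : Prop :=
  IsEFilt ξ ∧ ∀ η : Set S, IsEFilt η → ξ ⊆ η → ξ = η

/-- `β_s(ξ) = {f ∈ E : s·e·s⁻¹ ≤ f for some e ∈ ξ}`. -/
def beta (s : S) (ξ : Set S) : Set S :=
  {f : S | f ∈ E S ∧ ∃ e ∈ ξ, sle (s * e * s⁻¹) f}

/-- The set of proper filters in `S`. -/
abbrev PFilt (S : Type*) [InvSemigroupWithZero S] := {F : Set S // IsPFilt F}

/-- The patch topology on the set of proper filters, generated by the sets
`F(s;T) = {F : s ∈ F, F ∩ T = ∅}` for `s ∈ S` and finite `T ⊆ ↓s`. -/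
instance patchTopology : TopologicalSpace (PFilt S) :=
  TopologicalSpace.generateFrom
    {O : Set (PFilt S) | ∃ (s : S) (T : Set S), T.Finite ∧ T ⊆ dwn s ∧
      O = {F : PFilt S | s ∈ F.1 ∧ F.1 ∩ T = ∅}}

/-- The set of idempotent proper filters in `S`. -/
abbrev IPFilt (S : Type*) [InvSemigroupWithZero S] :=
  {F : Set S // IsPFilt F ∧ (F ∩ E S).Nonempty}

/-- The subspace topology induced by the patch topology on proper filters. -/
instance : TopologicalSpace (IPFilt S) :=
  TopologicalSpace.induced (fun F => (⟨F.1, F.2.1⟩ : PFilt S)) inferInstance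

/-- The set of `E`-filters. -/
abbrev EFilt (S : Type*) [InvSemigroupWithZero S] := {ξ : Set S // IsEFilt ξ}

/-- The patch topology on the set of `E`-filters, generated by the sets
`P(e;X) = {ξ : e ∈ ξ, ξ ∩ X = ∅}` for `e ∈ E` and finite `X ⊆ ↓e ∩ E`. -/
instance : TopologicalSpace (EFilt S) :=
  TopologicalSpace.generateFrom
    {O : Set (EFilt S) | ∃ (e : S) (X : Set S), e ∈ E S ∧ X.Finite ∧ X ⊆ edwn e ∧
      O = {ξ : EFilt S | e ∈ ξ.1 ∧ ξ.1 ∩ X = ∅}}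

/-- The set of ultrafilters in `S`. -/
abbrev UFilt (S : Type*) [InvSemigroupWithZero S] := {U : Set S // IsUltra U}

/-- The subspace topology induced by the patch topology on proper filters. -/
instance : TopologicalSpace (UFilt S) :=
  TopologicalSpace.induced (fun U => (⟨U.1, U.2.1⟩ : PFilt S)) inferInstance

end InvSemigroupWithZero

open InvSemigroupWithZero

namespace InvSemigroupWithZero

theorem inv_eq_self_of_mem_E {S : Type*} [InvSemigroupWithZero S] {e : S} (he : e * e = e) :
    e⁻¹ = e :=
  (inv_unique e e (by rw [he, he]) (by rw [he, he])).symm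

theorem inv_inv_eq {S : Type*} [InvSemigroupWithZero S] (a : S) : a⁻¹⁻¹ = a :=
  (inv_unique a⁻¹ a (inv_mul_inv a) (mul_inv_mul a)).symm

/-- A product of idempotents is idempotent. -/
theorem mul_mem_E {S : Type*} [InvSemigroupWithZero S] {e f : S}
    (he : e * e = e) (hf : f * f = f) : (e * f) * (e * f) = e * f := by
  have h₁ := mul_inv_mul (e * f)
  have h₂ := inv_mul_inv (e * f)
  have he' : ∀ y, e * (e * y) = e * y := fun y => by rw [← mul_assoc, he]
  have hf' : ∀ y, f * (f * y) = f * y := fun y => by rw [← mul_assoc, hf]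
  set x := (e * f)⁻¹ with hx
  have h₂' : ∀ y, x * (e * (f * (x * y))) = x * y := fun y => by
    simpa only [mul_assoc] using congrArg (· * y) h₂
  have key : f * x * e = x := inv_unique (e * f) (f * x * e)
    (by simpa only [mul_assoc, he', hf'] using h₁)
    (by simp only [mul_assoc, he', hf', h₂'])
  have hxx : x * x = x := by
    calc x * x = (f * x * e) * (f * x * e) := by rw [key]
      _ = f * x * e := by simp only [mul_assoc, h₂']
      _ = x := key
  have hef : e * f = x := by rw [← inv_inv_eq (e * f), ← hx, inv_eq_self_of_mem_E hxx]
  rw [hef, hxx]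

/-- Idempotents of an inverse semigroup commute. -/
theorem mul_comm_of_mem_E {S : Type*} [InvSemigroupWithZero S] {e f : S}
    (he : e * e = e) (hf : f * f = f) : e * f = f * e := by
  have h₁ := mul_mem_E he hf
  have h₂ := mul_mem_E hf he
  have he' : ∀ y, e * (e * y) = e * y := fun y => by rw [← mul_assoc, he]
  have hf' : ∀ y, f * (f * y) = f * y := fun y => by rw [← mul_assoc, hf]
  have key : f * e = (e * f)⁻¹ := inv_unique (e * f) (f * e)
    (by simpa only [mul_assoc, he', hf'] using h₁)
    (by simpa only [mul_assoc, he', hf'] using h₂)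
  rw [key, inv_eq_self_of_mem_E h₁]

theorem mul_inv_mem_E {S : Type*} [InvSemigroupWithZero S] (a : S) :
    (a * a⁻¹) * (a * a⁻¹) = a * a⁻¹ := by
  rw [← mul_assoc, mul_inv_mul]

theorem sle_refl {S : Type*} [InvSemigroupWithZero S] (a : S) : sle a a :=
  (mul_inv_mul a).symm

theorem sle_iff_ele {S : Type*} [InvSemigroupWithZero S] {e : S} (he : e ∈ E S) (b : S) :
    sle e b ↔ ele e b := by
  have he : e * e = e := he
  rw [sle, ele, inv_eq_self_of_mem_E he, he]

/-- The idempotents form a down-set. -/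
theorem mem_E_of_sle {S : Type*} [InvSemigroupWithZero S] {a e : S} (he : e ∈ E S)
    (h : sle a e) : a ∈ E S := by
  have h' : a = a * a⁻¹ * e := h
  have := mul_mem_E (mul_inv_mem_E a) he
  rwa [← h'] at this

theorem ele_trans {S : Type*} [InvSemigroupWithZero S] {a b c : S} (hab : ele a b)
    (hbc : ele b c) : ele a c := by
  have hab : a = a * b := hab
  have hbc : b = b * c := hbc
  change a = a * c
  calc a = a * b := hab
    _ = a * (b * c) := by rw [← hbc]
    _ = a * c := by rw [← mul_assoc, ← hab]

theorem ele_trans_sle {S : Type*} [InvSemigroupWithZero S] {e b c : S} (he : e ∈ E S)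
    (heb : ele e b) (hbc : sle b c) : ele e c := by
  have heb : e = e * b := heb
  have hbc : b = b * b⁻¹ * c := hbc
  have hf : e * (b * b⁻¹) = e := by
    have hcomm := mul_comm_of_mem_E he (mul_inv_mem_E b)
    calc e * (b * b⁻¹) = b * b⁻¹ * e := hcomm
      _ = b * b⁻¹ * (e * b) := by rw [← heb]
      _ = e * (b * b⁻¹) * b := by rw [← mul_assoc, hcomm]
      _ = e * b := by rw [mul_assoc, mul_inv_mul]
      _ = e := heb.symm
  change e = e * c
  calc e = e * b := heb
    _ = e * (b * b⁻¹ * c) := by rw [← hbc]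
    _ = e * c := by rw [← mul_assoc, hf]

theorem subset_up {S : Type*} [InvSemigroupWithZero S] (A : Set S) : A ⊆ up A :=
  fun a ha => ⟨a, ha, sle_refl a⟩

theorem isEFilt_inter_E {S : Type*} [InvSemigroupWithZero S] {F : Set S} (hF : IsPFilt F)
    (hne : (F ∩ E S).Nonempty) : IsEFilt (F ∩ E S) := by
  obtain ⟨⟨-, hup, hdir⟩, h0⟩ := hF
  refine ⟨Set.inter_subset_right, hne, ?_, ?_, fun h => h0 h.1⟩
  · ext f
    refine ⟨?_, fun hf => ⟨hf.2, f, hf, Eq.symm hf.2⟩⟩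
    rintro ⟨hf, a, ha, haf⟩
    exact ⟨hup ▸ ⟨a, ha.1, (sle_iff_ele ha.2 f).2 haf⟩, hf⟩
  · intro a ha b hb
    obtain ⟨c, hc, hca, hcb⟩ := hdir a ha.1 b hb.1
    have hcE := mem_E_of_sle ha.2 hca
    exact ⟨c, ⟨hc, hcE⟩, (sle_iff_ele hcE a).1 hca, (sle_iff_ele hcE b).1 hcb⟩

theorem isPFilt_up {S : Type*} [InvSemigroupWithZero S] {ξ : Set S} (hξ : IsEFilt ξ) :
    IsPFilt (up ξ) := by
  obtain ⟨hE, hne, -, hdir, h0⟩ := hξ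
  refine ⟨⟨hne.mono (subset_up ξ), (subset_up _).antisymm' ?_, ?_⟩, ?_⟩
  · rintro b ⟨a, ⟨e, he, hea⟩, hab⟩
    exact ⟨e, he, (sle_iff_ele (hE he) b).2
      (ele_trans_sle (hE he) ((sle_iff_ele (hE he) a).1 hea) hab)⟩
  · rintro a ⟨e, he, hea⟩ b ⟨f, hf, hfb⟩
    obtain ⟨c, hc, hce, hcf⟩ := hdir e he f hf
    exact ⟨c, subset_up ξ hc,
      (sle_iff_ele (hE hc) a).2 (ele_trans hce ((sle_iff_ele (hE he) a).1 hea)),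
      (sle_iff_ele (hE hc) b).2 (ele_trans hcf ((sle_iff_ele (hE hf) b).1 hfb))⟩
  · rintro ⟨e, he, h⟩
    have h : e = e * e⁻¹ * 0 := h
    rw [InvSemigroupWithZero.mul_zero] at h
    exact h0 (h ▸ he)

theorem up_inter_E_of_isPFilt {S : Type*} [InvSemigroupWithZero S] {F : Set S}
    (hF : IsPFilt F) (hne : (F ∩ E S).Nonempty) : up (F ∩ E S) = F := by
  obtain ⟨⟨-, hup, hdir⟩, -⟩ := hF
  obtain ⟨e, he, heE⟩ := hne
  ext b
  constructor
  · rintro ⟨a, ha, hab⟩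
    exact hup ▸ ⟨a, ha.1, hab⟩
  · intro hb
    obtain ⟨c, hc, hcb, hce⟩ := hdir b hb e he
    exact ⟨c, ⟨hc, mem_E_of_sle heE hce⟩, hcb⟩

theorem up_inter_E_of_isEFilt {S : Type*} [InvSemigroupWithZero S] {ξ : Set S}
    (hξ : IsEFilt ξ) : up ξ ∩ E S = ξ := by
  obtain ⟨hE, -, hup, -⟩ := hξ
  refine Set.Subset.antisymm ?_ fun e he => ⟨subset_up ξ he, hE he⟩
  rintro f ⟨⟨a, ha, haf⟩, hf⟩
  exact hup ▸ ⟨hf, a, ha, (sle_iff_ele (hE ha) f).1 haf⟩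

end InvSemigroupWithZero

/-- `ε(F) = F ∩ E` is a well-defined bijection from the idempotent proper
filters of `S` to the `E`-filters, with inverse `ξ ↦ ↑ξ`. -/
theorem stmt_1 {S : Type*} [InvSemigroupWithZero S] :
    (∀ F : Set S, IsPFilt F → (F ∩ E S).Nonempty → IsEFilt (F ∩ E S)) ∧
    (∀ ξ : Set S, IsEFilt ξ → IsPFilt (up ξ) ∧ ((up ξ) ∩ E S).Nonempty) ∧
    (∀ F : Set S, IsPFilt F → (F ∩ E S).Nonempty → up (F ∩ E S) = F) ∧
    (∀ ξ : Set S, IsEFilt ξ → (up ξ) ∩ E S = ξ) := by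
  refine ⟨fun F hF hne => isEFilt_inter_E hF hne, fun ξ hξ => ⟨isPFilt_up hξ, ?_⟩,
    fun F hF hne => up_inter_E_of_isPFilt hF hne, fun ξ hξ => up_inter_E_of_isEFilt hξ⟩
  rw [up_inter_E_of_isEFilt hξ]
  exact hξ.2.1
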